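/- Let T > 0, X₀ > 0, σ_Bac > 0 and σ_BS > 0. If the at-the-money Bachelier and Black–Scholes prices coincide, i.e. Bac(T, X₀, X₀, σ_Bac) = BS(T, X₀, X₀, σ_BS), then σ_Bac = (√(2π)/√T) · X₀ · (2·N(σ_BS·√T/2) − 1). (Conversion formula between at-the-money Bachelier and Black–Scholes implied volatilities.) -/

import Mathlib

open MeasureTheory ProbabilityTheory Real NNReal

/-- Standard normal cumulative distribution function. -/
noncomputable def normalCDF (z : ℝ) : ℝ :=
  ∫ t in Set.Iic z, Real.exp (-t ^ 2 / 2) / Real.sqrt (2 * Real.pi)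

/-- Standard normal probability density function. -/
noncomputable def normalPDF (z : ℝ) : ℝ :=
  Real.exp (-z ^ 2 / 2) / Real.sqrt (2 * Real.pi)

/-- Bachelier moneyness. -/
noncomputable def dBac (T x k σ : ℝ) : ℝ := (x - k) / (σ * Real.sqrt T)

/-- Bachelier call price. -/
noncomputable def Bac (T x k σ : ℝ) : ℝ :=
  (x - k) * normalCDF (dBac T x k σ) + σ * Real.sqrt T * normalPDF (dBac T x k σ)

/-- Black–Scholes call price. -/
noncomputable def BS (T x k σ : ℝ) : ℝ :=
  x * normalCDF ((Real.log (x / k) + σ ^ 2 * T / 2) / (σ * Real.sqrt T)) -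
  k * normalCDF ((Real.log (x / k) + σ ^ 2 * T / 2) / (σ * Real.sqrt T) - σ * Real.sqrt T)

theorem integrable_normalPDF : Integrable normalPDF := by
  have h := (integrable_exp_neg_mul_sq (b := 1 / 2) (by norm_num)).div_const √(2 * π)
  refine h.congr (Filter.Eventually.of_forall fun t => ?_)
  simp only [normalPDF]
  ring_nf

theorem integral_normalPDF : ∫ t, normalPDF t = 1 := by
  have h : ∀ t : ℝ, normalPDF t = Real.exp (-(1 / 2) * t ^ 2) / √(2 * π) := fun t => by
    simp only [normalPDF]
    ring_nf
  simp_rw [h]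
  rw [integral_div, integral_gaussian, show π / (1 / 2) = 2 * π by ring]
  exact div_self (by positivity)

theorem normalCDF_neg (z : ℝ) : normalCDF (-z) = 1 - normalCDF z := by
  have h_neg : normalCDF (-z) = ∫ t in Set.Ioi z, normalPDF t := by
    have h := integral_comp_neg_Iic (-z) normalPDF
    rw [neg_neg] at h
    rw [← h]
    simp only [normalCDF, normalPDF, neg_sq]
  have h_add := integral_add_compl (measurableSet_Iic (a := z)) integrable_normalPDF
  rw [Set.compl_Iic, integral_normalPDF, ← h_neg] at h_add
  have h_cdf : normalCDF z = ∫ t in Set.Iic z, normalPDF t := rfl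
  linarith

/-- The at-the-money Bachelier price. -/
theorem Bac_self (T x σ : ℝ) : Bac T x x σ = σ * √T / √(2 * π) := by
  simp [Bac, dBac, normalPDF, div_eq_mul_inv]

/-- The at-the-money Black–Scholes price. -/
theorem BS_self {T x σ : ℝ} (hT : 0 < T) (hx : x ≠ 0) (hσ : σ ≠ 0) :
    BS T x x σ = x * (2 * normalCDF (σ * √T / 2) - 1) := by
  have h_sqrt : √T ≠ 0 := (Real.sqrt_pos.mpr hT).ne'
  have h_d₁ : (Real.log (x / x) + σ ^ 2 * T / 2) / (σ * √T) = σ * √T / 2 := by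
    rw [div_self hx, Real.log_one, zero_add]
    field_simp
    rw [Real.sq_sqrt hT.le]
  rw [BS, h_d₁, show σ * √T / 2 - σ * √T = -(σ * √T / 2) by ring, normalCDF_neg]
  ring

/-- Conversion formula between at-the-money Bachelier and Black–Scholes
implied volatilities. -/
theorem atm_bachelier_blackscholes_conversion
    (T X₀ σBac σBS : ℝ) (hT : 0 < T) (hX₀ : 0 < X₀) (hb : 0 < σBac) (hs : 0 < σBS)
    (h : Bac T X₀ X₀ σBac = BS T X₀ X₀ σBS) :
    σBac = Real.sqrt (2 * Real.pi) / Real.sqrt T * X₀ *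
      (2 * normalCDF (σBS * Real.sqrt T / 2) - 1) := by
  rw [Bac_self, BS_self hT hX₀.ne' hs.ne'] at h
  have h_sqrt : 0 < √T := Real.sqrt_pos.mpr hT
  have h_pi : 0 < √(2 * π) := by positivity
  rw [mul_assoc, ← h]
  field_simp
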